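/- Let 1 ≤ p < q < ∞ and let f be a measurable function on ℝ² whose a.e. sections f_x and f_y belong to Lip(1/p), with φ_{p,1}(y) = ‖f_y‖*_{Lip 1/p} and φ_{p,2}(x) = ‖f_x‖*_{Lip 1/p} in L^{p,1}(ℝ). Define φ_{q,1}(y) = sup_{h>0} h^{−1/q} ‖f(·+h, y) − f(·, y)‖_∞ and φ_{q,2}(x) = sup_{h>0} h^{−1/q} ‖f(x, ·+h) − f(x, ·)‖_∞. Then ‖φ_{q,1}‖_{L^{q,1}} + ‖φ_{q,2}‖_{L^{q,1}} ≤ 2⁷ q ( ‖φ_{p,1}‖_{L^{p,1}} + ‖φ_{p,2}‖_{L^{p,1}} ). -/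

import Mathlib

open MeasureTheory Set
open scoped ENNReal

noncomputable section

/-- Extended essential sup norm on ℝ. -/
def einf (φ : ℝ → ℝ) : ℝ≥0∞ := eLpNorm φ ⊤ volume

/-- Lipschitz `α` seminorm (extended real valued):
`sup_{h>0} h^{-α} ‖φ(·+h) - φ‖_∞`. -/
def lipSemiE (α : ℝ) (φ : ℝ → ℝ) : ℝ≥0∞ :=
  ⨆ h ∈ Ioi (0:ℝ), ENNReal.ofReal (h ^ (-α)) * einf (fun x => φ (x + h) - φ x)

/-- Real-valued Lipschitz `α` seminorm `‖φ‖*_{Lip α}`. -/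
def lipSemi (α : ℝ) (φ : ℝ → ℝ) : ℝ := (lipSemiE α φ).toReal

/-- `φ ∈ Lip α`: essentially bounded with finite Lipschitz `α` seminorm. -/
def MemLip (α : ℝ) (φ : ℝ → ℝ) : Prop := einf φ < ⊤ ∧ lipSemiE α φ < ⊤

/-- `‖φ‖_{Lip α} = ‖φ‖_∞ + ‖φ‖*_{Lip α}`. -/
def lipNorm (α : ℝ) (φ : ℝ → ℝ) : ℝ := (einf φ + lipSemiE α φ).toReal

/-- The class `S₀`: measurable functions with finite distribution function at every
positive level. -/
def S0 {X : Type*} [MeasureSpace X] (f : X → ℝ) : Prop :=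
  Measurable f ∧ ∀ s : ℝ, 0 < s → volume {x | s < |f x|} < ⊤

/-- The non-increasing rearrangement `f*`. -/
def rearr {X : Type*} [MeasureSpace X] (f : X → ℝ) (t : ℝ) : ℝ :=
  sInf {s : ℝ | 0 ≤ s ∧ volume {x | s < |f x|} ≤ ENNReal.ofReal t}

/-- `f**(t) = (1/t) ∫₀^t f*(u) du`. -/
def doubleStar {X : Type*} [MeasureSpace X] (f : X → ℝ) (t : ℝ) : ℝ :=
  (∫ u in Ioc (0:ℝ) t, rearr f u) / t

/-- Lorentz `L^{p,q}` norm. -/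
def lorentzNorm {X : Type*} [MeasureSpace X] (p q : ℝ) (f : X → ℝ) : ℝ :=
  (∫ t in Ioi (0:ℝ), (t ^ (1/p) * rearr f t) ^ q / t) ^ (1/q)

/-- Membership in the Lorentz space `L^{p,q}`. -/
def MemLorentz {X : Type*} [MeasureSpace X] (p q : ℝ) (f : X → ℝ) : Prop :=
  S0 f ∧ IntegrableOn (fun t => (t ^ (1/p) * rearr f t) ^ q / t) (Ioi (0:ℝ))

/-- The space `U_p(ℝ²)`: a.e. sections in `Lip (1/p)`, with `Lip (1/p)` norms of the
sections in `L^{p,1}(ℝ)`. -/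
def MemUp (p : ℝ) (f : ℝ × ℝ → ℝ) : Prop :=
  Measurable f ∧
  (∀ᵐ y : ℝ ∂volume, MemLip (1/p) (fun x => f (x, y))) ∧
  (∀ᵐ x : ℝ ∂volume, MemLip (1/p) (fun y => f (x, y))) ∧
  MemLorentz p 1 (fun y => lipNorm (1/p) (fun x => f (x, y))) ∧
  MemLorentz p 1 (fun x => lipNorm (1/p) (fun y => f (x, y)))

/-- The Steklov-type average `f_h`. -/
def avg (f : ℝ × ℝ → ℝ) (h : ℝ) (z : ℝ × ℝ) : ℝ :=
  (∫ u in Ioc (0:ℝ) h, ∫ v in Ioc (0:ℝ) h, f (z.1 + u, z.2 + v)) / h ^ 2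

open Filter Topology

lemma rearr_set_nonempty {φ : ℝ → ℝ} (h : S0 φ) {t : ℝ} (ht : 0 < t) :
    {s : ℝ | 0 ≤ s ∧ volume {x | s < |φ x|} ≤ ENNReal.ofReal t}.Nonempty := by
  have hlim : Tendsto (fun n : ℕ => volume {x | ((n : ℝ) + 1) < |φ x|}) atTop (𝓝 0) := by
    have hI : (⋂ n : ℕ, {x | ((n : ℝ) + 1) < |φ x|}) = ∅ := by
      ext x
      simp only [mem_iInter, mem_ofPred_eq, mem_empty_iff_false, iff_false, not_forall, not_lt]
      obtain ⟨n, hn⟩ := exists_nat_ge |φ x|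
      exact ⟨n, by linarith⟩
    have := tendsto_measure_iInter_atTop (μ := (volume : Measure ℝ))
      (s := fun n : ℕ => {x | ((n : ℝ) + 1) < |φ x|})
      (fun n => (measurableSet_lt measurable_const h.1.abs).nullMeasurableSet)
      (fun m n hmn x hx => by
        have : (m : ℝ) ≤ n := by exact_mod_cast hmn
        simp only [mem_ofPred_eq] at hx ⊢
        linarith)
      ⟨0, (h.2 _ (by positivity)).ne⟩
    rwa [hI, measure_empty] at this
  obtain ⟨n, hn⟩ := (hlim.eventually_lt_const
    (show (0 : ℝ≥0∞) < ENNReal.ofReal t by simpa using ht)).exists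
  exact ⟨n + 1, by positivity, hn.le⟩

lemma rearr_bddBelow (φ : ℝ → ℝ) (t : ℝ) :
    BddBelow {s : ℝ | 0 ≤ s ∧ volume {x | s < |φ x|} ≤ ENNReal.ofReal t} :=
  ⟨0, fun _ hs => hs.1⟩

lemma rearr_nonneg (φ : ℝ → ℝ) (t : ℝ) : 0 ≤ rearr φ t :=
  Real.sInf_nonneg fun _ hs => hs.1

lemma rearr_le_of_measure_le {φ : ℝ → ℝ} {t s : ℝ} (hs : 0 ≤ s)
    (h : volume {x | s < |φ x|} ≤ ENNReal.ofReal t) : rearr φ t ≤ s :=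
  csInf_le (rearr_bddBelow φ t) ⟨hs, h⟩

lemma measure_rearr_lt_le {φ : ℝ → ℝ} (h : S0 φ) {t : ℝ} (ht : 0 < t) :
    volume {x | rearr φ t < |φ x|} ≤ ENNReal.ofReal t := by
  have hU : {x | rearr φ t < |φ x|} = ⋃ n : ℕ, {x | rearr φ t + 1 / ((n : ℝ) + 1) < |φ x|} := by
    ext x
    simp only [mem_ofPred_eq, mem_iUnion]
    constructor
    · intro hx
      obtain ⟨n, hn⟩ := exists_nat_one_div_lt (sub_pos.2 hx)
      exact ⟨n, by linarith⟩
    · rintro ⟨n, hn⟩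
      have : (0 : ℝ) < 1 / ((n : ℝ) + 1) := by positivity
      linarith
  have hmono : Monotone fun n : ℕ => {x | rearr φ t + 1 / ((n : ℝ) + 1) < |φ x|} := by
    intro m n hmn x hx
    have : 1 / ((n : ℝ) + 1) ≤ 1 / ((m : ℝ) + 1) := Nat.one_div_le_one_div hmn
    simp only [mem_ofPred_eq] at hx ⊢
    linarith
  rw [hU, hmono.measure_iUnion]
  refine iSup_le fun n => ?_
  obtain ⟨s, hs, hlt⟩ := exists_lt_of_csInf_lt (rearr_set_nonempty h ht)
    (show rearr φ t < rearr φ t + 1 / ((n : ℝ) + 1) from lt_add_of_pos_right _ (by positivity))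
  refine le_trans (measure_mono fun x hx => ?_) hs.2
  exact lt_trans hlt hx

lemma rearr_antitoneOn {φ : ℝ → ℝ} (h : S0 φ) : AntitoneOn (rearr φ) (Ioi 0) := by
  intro s hs t _ hst
  exact csInf_le_csInf (rearr_bddBelow φ t) (rearr_set_nonempty h hs)
    fun u hu => ⟨hu.1, hu.2.trans (ENNReal.ofReal_le_ofReal hst)⟩

/-- The points at which `φ` satisfies the Hölder condition against almost every point. -/
def holderPts (α c : ℝ) (φ : ℝ → ℝ) : Set ℝ :=
  {x | ∀ᵐ x' : ℝ, |φ x - φ x'| ≤ |x - x'| ^ α * c}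

lemma abs_sub_le_of_mem_holderPts {α c : ℝ} (hα : 0 < α) {φ : ℝ → ℝ} {x x' : ℝ}
    (hx : x ∈ holderPts α c φ) (hx' : x' ∈ holderPts α c φ) :
    |φ x - φ x'| ≤ |x - x'| ^ α * c := by
  have hd : Dense {z : ℝ | |φ x - φ z| ≤ |x - z| ^ α * c ∧ |φ x' - φ z| ≤ |x' - z| ^ α * c} :=
    Measure.dense_of_ae (μ := volume) (by filter_upwards [hx, hx'] with z h1 h2 using ⟨h1, h2⟩)
  obtain ⟨u, hu, hlim⟩ := mem_closure_iff_seq_limit.1 (hd x)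
  have hc : Continuous fun z : ℝ => |x - z| ^ α * c + |x' - z| ^ α * c := by
    have h (w : ℝ) : Continuous fun z : ℝ => |w - z| ^ α :=
      (continuous_const.sub continuous_id).abs.rpow_const fun _ => Or.inr hα.le
    exact ((h x).mul_const c).add ((h x').mul_const c)
  have hl := (hc.tendsto x).comp hlim
  refine le_trans (ge_of_tendsto' (b := |φ x - φ x'|) hl fun n => ?_) (le_of_eq ?_)
  · have h1 := (hu n).1
    have h2 := (hu n).2
    have h3 := abs_sub_le (φ x) (φ (u n)) (φ x')
    rw [abs_sub_comm (φ (u n)) (φ x')] at h3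
    simp only [Function.comp_apply]
    linarith
  · simp [Real.zero_rpow hα.ne', abs_sub_comm x' x]

lemma ae_mem_holderPts {α : ℝ} (hα : 0 < α) {φ : ℝ → ℝ} (hφ : Measurable φ)
    (h : MemLip α φ) : ∀ᵐ x, x ∈ holderPts α (lipSemi α φ) φ := by
  set c := lipSemi α φ with hc
  have hc' : lipSemiE α φ = ENNReal.ofReal c := (ENNReal.ofReal_toReal h.2.ne).symm
  have hc0 : 0 ≤ c := ENNReal.toReal_nonneg
  have hpos : ∀ k : ℝ, 0 < k → ∀ᵐ x : ℝ, |φ (x + k) - φ x| ≤ |k| ^ α * c := by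
    intro k hk
    have hk1 : ENNReal.ofReal (k ^ (-α)) * einf (fun x => φ (x + k) - φ x) ≤ ENNReal.ofReal c := by
      rw [← hc']
      exact le_iSup₂ (f := fun k (_ : k ∈ Ioi (0:ℝ)) =>
        ENNReal.ofReal (k ^ (-α)) * einf (fun x => φ (x + k) - φ x)) k hk
    have hb : ∀ᵐ x : ℝ, ‖φ (x + k) - φ x‖ₑ ≤ einf (fun x => φ (x + k) - φ x) := by
      simpa [einf] using ae_le_eLpNormEssSup (f := fun x => φ (x + k) - φ x) (μ := volume)
    filter_upwards [hb] with x hx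
    have h1 : ENNReal.ofReal (k ^ (-α)) * ‖φ (x + k) - φ x‖ₑ ≤ ENNReal.ofReal c :=
      le_trans (by gcongr) hk1
    rw [Real.enorm_eq_ofReal_abs, ← ENNReal.ofReal_mul (by positivity),
      ENNReal.ofReal_le_ofReal_iff hc0, Real.rpow_neg hk.le] at h1
    rw [abs_of_pos hk]
    rwa [inv_mul_le_iff₀ (by positivity)] at h1
  have hall : ∀ k : ℝ, ∀ᵐ x : ℝ, |φ x - φ (k + x)| ≤ |k| ^ α * c := by
    intro k
    rcases lt_trichotomy k 0 with hk | rfl | hk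
    · have := (measurePreserving_add_left volume k).quasiMeasurePreserving.ae
        (hpos (-k) (by linarith))
      filter_upwards [this] with x hx
      simpa [abs_neg] using hx
    · simp [Real.zero_rpow hα.ne']
    · filter_upwards [hpos k hk] with x hx
      rwa [abs_sub_comm, add_comm k]
  have hsw : ∀ᵐ x : ℝ, ∀ᵐ k : ℝ, |φ x - φ (k + x)| ≤ |k| ^ α * c := by
    rw [Measure.ae_ae_comm]
    · exact Eventually.of_forall hall
    · exact measurableSet_le (by fun_prop) (by fun_prop)
  filter_upwards [hsw] with x hx
  have := (measurePreserving_sub_right volume x).quasiMeasurePreserving.ae hx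
  filter_upwards [this] with x' hx'
  rwa [sub_add_cancel, abs_sub_comm x' x] at hx'

lemma measurableSet_setOf_mem_holderPts {α : ℝ} {f : ℝ → ℝ → ℝ}
    (hf : Measurable (Function.uncurry f)) {c : ℝ → ℝ} (hc : Measurable c) :
    MeasurableSet {z : ℝ × ℝ | z.2 ∈ holderPts α (c z.1) (f z.1)} := by
  have h1 : Measurable fun w : (ℝ × ℝ) × ℝ => f w.1.1 w.1.2 := hf.comp measurable_fst
  have h2 : Measurable fun w : (ℝ × ℝ) × ℝ => f w.1.1 w.2 :=
    hf.comp (measurable_fst.fst.prodMk measurable_snd)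
  have hR : MeasurableSet {w : (ℝ × ℝ) × ℝ |
      |f w.1.1 w.1.2 - f w.1.1 w.2| ≤ |w.1.2 - w.2| ^ α * c w.1.1} :=
    measurableSet_le (h1.sub h2).abs (by fun_prop)
  exact measurable_measure_prodMk_left (ν := (volume : Measure ℝ)) hR.compl
    (measurableSet_singleton 0)

/-- `f` satisfies Hölder conditions along the rows and columns of an almost full set `F`, with
constants `φ₁` and `φ₂` whose distributions are controlled by the decreasing functions `a`
and `b`. -/
structure IsHolderGrid (α : ℝ) (f : ℝ → ℝ → ℝ) (F : ℝ → ℝ → Prop) (φ₁ φ₂ a b : ℝ → ℝ) :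
    Prop where
  row : ∀ y x x', F x y → F x' y → |f x y - f x' y| ≤ |x - x'| ^ α * φ₁ y
  col : ∀ x y y', F x y → F x y' → |f x y - f x y'| ≤ |y - y'| ^ α * φ₂ x
  ae_row : ∀ᵐ y, ∀ᵐ x, F x y
  ae_col : ∀ᵐ x, ∀ᵐ y, F x y
  anti₁ : AntitoneOn a (Ioi 0)
  anti₂ : AntitoneOn b (Ioi 0)
  const_nonneg₁ : ∀ y, 0 ≤ φ₁ y
  const_nonneg₂ : ∀ x, 0 ≤ φ₂ x
  nonneg₁ : ∀ t, 0 ≤ a t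
  nonneg₂ : ∀ t, 0 ≤ b t
  meas₁ : ∀ t, 0 < t → volume {y | a t < φ₁ y} ≤ ENNReal.ofReal t
  meas₂ : ∀ t, 0 < t → volume {x | b t < φ₂ x} ≤ ENNReal.ofReal t

lemma IsHolderGrid.swap {α : ℝ} {f : ℝ → ℝ → ℝ} {F : ℝ → ℝ → Prop} {φ₁ φ₂ a b : ℝ → ℝ}
    (h : IsHolderGrid α f F φ₁ φ₂ a b) :
    IsHolderGrid α (fun x y => f y x) (fun x y => F y x) φ₂ φ₁ b a :=
  ⟨h.col, h.row, h.ae_col, h.ae_row, h.anti₂, h.anti₁, h.const_nonneg₂, h.const_nonneg₁,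
    h.nonneg₂, h.nonneg₁, h.meas₂, h.meas₁⟩

/-- Points with a small value of `φ` can be found near any given point, subject to any condition
that holds almost everywhere. -/
lemma exists_near_of_measure_lt_le {φ : ℝ → ℝ} {c t : ℝ} (ht : 0 < t)
    (h : volume {x | c < φ x} ≤ ENNReal.ofReal t) {P : ℝ → Prop} (hP : ∀ᵐ x, P x) (x₀ : ℝ) :
    ∃ x, P x ∧ φ x ≤ c ∧ |x₀ - x| ≤ t := by
  by_contra! hcon
  have hsub : Icc (x₀ - t) (x₀ + t) ⊆ {x | c < φ x} ∪ {x | ¬ P x} := by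
    intro x hx
    by_cases hPx : P x
    · left
      by_contra hcx
      have := hcon x hPx (not_lt.1 hcx)
      have h2 : |x₀ - x| ≤ t := abs_le.2 ⟨by linarith [hx.2], by linarith [hx.1]⟩
      linarith
    · exact Or.inr hPx
  have h1 := (measure_mono hsub).trans (measure_union_le (μ := (volume : Measure ℝ)) _ _)
  rw [ae_iff.1 hP, add_zero, Real.volume_Icc] at h1
  have h2 := (ENNReal.ofReal_le_ofReal_iff ht.le).1 (h1.trans h)
  linarith

lemma IsHolderGrid.step {α : ℝ} {f : ℝ → ℝ → ℝ} {F : ℝ → ℝ → Prop} {φ₁ φ₂ a b : ℝ → ℝ}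
    (h : IsHolderGrid α f F φ₁ φ₂ a b) (hα : 0 < α) (hα1 : α ≤ 1) {t : ℝ} (ht : 0 < t)
    {y x x' : ℝ} (hy : ∀ᵐ x, F x y) (hay : φ₁ y ≤ a t) (hx : F x y) (hx' : F x' y) :
    ∃ y₁ x₁ x₁', (∀ᵐ x, F x y₁) ∧ φ₁ y₁ ≤ a (2 * t) ∧ F x₁ y₁ ∧ F x₁' y₁ ∧
      |x₁ - x₁'| ≤ |x - x'| + 2 * t ∧
      |f x y - f x' y| ≤ t ^ α * (2 * a t + 4 * b t) + |f x₁ y₁ - f x₁' y₁| := by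
  have hnear (z : ℝ) := exists_near_of_measure_lt_le ht (h.meas₂ t ht) (hy.and h.ae_col) z
  obtain ⟨x₁, ⟨hF1, hc1⟩, hb1, hd1⟩ := hnear x
  obtain ⟨x₁', ⟨hF1', hc1'⟩, hb1', hd1'⟩ := hnear x'
  obtain ⟨y₁, ⟨⟨hG, hG'⟩, hr⟩, hya, hyd⟩ := exists_near_of_measure_lt_le (by positivity)
    (h.meas₁ (2 * t) (by positivity)) ((hc1.and hc1').and h.ae_row) y
  refine ⟨y₁, x₁, x₁', hr, hya, hG, hG', ?_, ?_⟩
  · have e1 := abs_sub_le x₁ x x₁'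
    have e2 := abs_sub_le x x' x₁'
    rw [abs_sub_comm x₁ x] at e1
    linarith
  · have hrow : ∀ z z₁, F z y → F z₁ y → |z - z₁| ≤ t → |f z y - f z₁ y| ≤ t ^ α * a t := by
      intro z z₁ hz hz₁ hd
      refine (h.row y z z₁ hz hz₁).trans ?_
      have := h.const_nonneg₁ y
      gcongr
    have h2 : (2 * t) ^ α ≤ 2 * t ^ α := by
      rw [Real.mul_rpow (by norm_num) ht.le]
      gcongr
      simpa using Real.rpow_le_rpow_of_exponent_le (by norm_num : (1:ℝ) ≤ 2) hα1
    have hcol : ∀ z, F z y → F z y₁ → φ₂ z ≤ b t → |f z y - f z y₁| ≤ t ^ α * (2 * b t) := by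
      intro z hz hz₁ hd
      refine (h.col z y y₁ hz hz₁).trans ?_
      have := h.const_nonneg₂ z
      have := h.nonneg₂ t
      calc |y - y₁| ^ α * φ₂ z ≤ (2 * t) ^ α * b t := by gcongr
        _ ≤ (2 * t ^ α) * b t := by gcongr
        _ = _ := by ring
    have e1 := hrow x x₁ hx hF1 hd1
    have e2 := hrow x' x₁' hx' hF1' hd1'
    have e3 := hcol x₁ hF1 hG hb1
    have e4 := hcol x₁' hF1' hG' hb1'
    have := abs_sub_le (f x y) (f x₁ y) (f x' y)
    have := abs_sub_le (f x₁ y) (f x₁ y₁) (f x' y)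
    have := abs_sub_le (f x₁ y₁) (f x₁' y₁) (f x' y)
    have := abs_sub_le (f x₁' y₁) (f x₁' y) (f x' y)
    rw [abs_sub_comm] at e2 e4
    linarith

/-- The tail integral `∫_{t/2}^∞ u^{γ-1} c(u) du`. -/
def tailInt (γ : ℝ) (c : ℝ → ℝ) (t : ℝ) : ℝ≥0∞ :=
  ∫⁻ u in Ioi (t / 2), ENNReal.ofReal (u ^ (γ - 1) * c u)

lemma ofReal_add_tailInt_le {γ : ℝ} (hγ1 : γ ≤ 1) {c : ℝ → ℝ}
    (hc : AntitoneOn c (Ioi 0)) (hc0 : ∀ t, 0 ≤ c t) {t : ℝ} (ht : 0 < t) :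
    ENNReal.ofReal (t ^ γ * c t / 2) + tailInt γ c (2 * t) ≤ tailInt γ c t := by
  have hu : Ioi (t / 2) = Ioc (t / 2) t ∪ Ioi t := (Ioc_union_Ioi_eq_Ioi (by linarith)).symm
  have h2 : 2 * t / 2 = t := by ring
  rw [tailInt, tailInt, h2, hu, lintegral_union measurableSet_Ioi
    (Set.disjoint_left.2 fun x hx hx' => not_lt.2 hx.2 hx')]
  gcongr
  calc ENNReal.ofReal (t ^ γ * c t / 2)
      = ∫⁻ _ in Ioc (t / 2) t, ENNReal.ofReal (t ^ (γ - 1) * c t) := by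
        rw [setLIntegral_const, Real.volume_Ioc, ← ENNReal.ofReal_mul
          (mul_nonneg (by positivity) (hc0 t)), Real.rpow_sub_one ht.ne']
        congr 1
        field_simp
        ring
    _ ≤ _ := by
        refine setLIntegral_mono' measurableSet_Ioc fun u hu => ENNReal.ofReal_le_ofReal ?_
        have hu0 : 0 < u := lt_trans (by positivity) hu.1
        exact mul_le_mul (Real.rpow_le_rpow_of_nonpos hu0 hu.2 (by linarith)) (hc hu0 ht hu.2)
          (hc0 t) (by positivity)

lemma IsHolderGrid.chain {α θ : ℝ} {f : ℝ → ℝ → ℝ} {F : ℝ → ℝ → Prop} {φ₁ φ₂ a b : ℝ → ℝ}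
    (h : IsHolderGrid α f F φ₁ φ₂ a b) (hα : 0 < α) (hα1 : α ≤ 1) (hθ : 0 < θ) (hθα : θ < α)
    {s : ℝ} (hs : 0 < s) (K : ℕ) {t : ℝ} (ht : 0 < t) (hK1 : 2 ^ K * t ≤ s)
    (hK2 : s < 2 ^ (K + 1) * t)
    {y x x' : ℝ} (hy : ∀ᵐ x, F x y) (hay : φ₁ y ≤ a t) (hx : F x y) (hx' : F x' y)
    (hd : |x - x'| + 2 * (2 ^ K - 1) * t ≤ 3 * s) :
    ENNReal.ofReal (s ^ (-θ) * |f x y - f x' y|) ≤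
      12 * tailInt (α - θ) (fun u => a u + b u) t := by
  have hanti : AntitoneOn (fun u => a u + b u) (Ioi 0) := h.anti₁.add h.anti₂
  have hnn : ∀ u, 0 ≤ a u + b u := fun u => add_nonneg (h.nonneg₁ u) (h.nonneg₂ u)
  induction K generalizing t y x x' with
  | zero =>
    have key : s ^ (-θ) * |f x y - f x' y| ≤
        12 * (t ^ (α - θ) * (a t + b t) / 2) := by
      have ha := h.nonneg₁ t
      have hb := h.nonneg₂ t
      have hpow {r : ℝ} (r0 : 0 < r) (r1 : r ≤ 1) {k : ℝ} (k1 : 1 ≤ k) : k ^ r ≤ k := by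
        simpa using Real.rpow_le_rpow_of_exponent_le k1 r1
      have e1 : |f x y - f x' y| ≤ 3 * s ^ α * a t := by
        refine (h.row y x x' hx hx').trans ?_
        have : (3 * s) ^ α ≤ 3 * s ^ α := by
          rw [Real.mul_rpow (by norm_num) hs.le]
          gcongr
          exact hpow hα hα1 (by norm_num)
        have hd' : |x - x'| ≤ 3 * s := by simpa using hd
        have := h.const_nonneg₁ y
        calc |x - x'| ^ α * φ₁ y ≤ (3 * s) ^ α * a t := by gcongr
          _ ≤ _ := by gcongr
      have e2 : s ^ (α - θ) ≤ 2 * t ^ (α - θ) := by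
        have hst : s ≤ 2 * t := by simpa using hK2.le
        calc s ^ (α - θ) ≤ (2 * t) ^ (α - θ) :=
              Real.rpow_le_rpow hs.le hst (by linarith)
          _ = 2 ^ (α - θ) * t ^ (α - θ) := Real.mul_rpow (by norm_num) ht.le
          _ ≤ _ := by
            gcongr
            exact hpow (by linarith) (by linarith) (by norm_num)
      have hT : 0 < t ^ (α - θ) := by positivity
      calc s ^ (-θ) * |f x y - f x' y| ≤ s ^ (-θ) * (3 * s ^ α * a t) := by gcongr
        _ = 3 * (s ^ (α - θ) * a t) := by
          rw [show α - θ = -θ + α by ring, Real.rpow_add hs]; ring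
        _ ≤ 3 * ((2 * t ^ (α - θ)) * a t) := by gcongr
        _ ≤ _ := by nlinarith [mul_nonneg hT.le hb]
    calc _ ≤ ENNReal.ofReal (12 * (t ^ (α - θ) * (a t + b t) / 2)) :=
          ENNReal.ofReal_le_ofReal key
      _ = 12 * ENNReal.ofReal (t ^ (α - θ) * (a t + b t) / 2) := by
          rw [ENNReal.ofReal_mul (by norm_num)]; norm_num
      _ ≤ _ := by
          gcongr
          exact le_trans le_self_add (ofReal_add_tailInt_le (by linarith) hanti hnn ht)
  | succ K ih =>
    obtain ⟨y₁, x₁, x₁', hr, hya, hG, hG', hdist, hdiff⟩ := h.step hα hα1 ht hy hay hx hx'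
    have hIH := ih (t := 2 * t) (by positivity) (by rw [pow_succ] at hK1; linarith)
      (by rw [pow_succ] at hK2; linarith) hr hya hG hG'
      (by rw [pow_succ] at hd; linarith)
    have hts : t ≤ s := le_trans (le_mul_of_one_le_left ht.le (one_le_pow₀ (by norm_num))) hK1
    have key : s ^ (-θ) * |f x y - f x' y| ≤ 12 * (t ^ (α - θ) * (a t + b t) / 2) +
        s ^ (-θ) * |f x₁ y₁ - f x₁' y₁| := by
      have ha := h.nonneg₁ t
      have hb := h.nonneg₂ t
      have hT : 0 < t ^ (α - θ) := by positivity
      have hsub : s ^ (-θ) * t ^ α ≤ t ^ (α - θ) := by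
        rw [show α - θ = -θ + α by ring, Real.rpow_add ht]
        exact mul_le_mul_of_nonneg_right
          (Real.rpow_le_rpow_of_nonpos ht hts (by linarith)) (by positivity)
      calc s ^ (-θ) * |f x y - f x' y|
          ≤ s ^ (-θ) * (t ^ α * (2 * a t + 4 * b t) + |f x₁ y₁ - f x₁' y₁|) := by gcongr
        _ = (s ^ (-θ) * t ^ α) * (2 * a t + 4 * b t) + s ^ (-θ) * |f x₁ y₁ - f x₁' y₁| := by
          ring
        _ ≤ t ^ (α - θ) * (2 * a t + 4 * b t) + s ^ (-θ) * |f x₁ y₁ - f x₁' y₁| := by gcongr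
        _ ≤ _ := by nlinarith [mul_nonneg hT.le hb, mul_nonneg hT.le ha]
    calc _ ≤ ENNReal.ofReal (12 * (t ^ (α - θ) * (a t + b t) / 2) +
          s ^ (-θ) * |f x₁ y₁ - f x₁' y₁|) := ENNReal.ofReal_le_ofReal key
      _ ≤ ENNReal.ofReal (12 * (t ^ (α - θ) * (a t + b t) / 2)) +
          ENNReal.ofReal (s ^ (-θ) * |f x₁ y₁ - f x₁' y₁|) := ENNReal.ofReal_add_le
      _ ≤ 12 * ENNReal.ofReal (t ^ (α - θ) * (a t + b t) / 2) +
          12 * tailInt (α - θ) (fun u => a u + b u) (2 * t) := by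
          rw [ENNReal.ofReal_mul (by norm_num)]
          gcongr
          norm_num
      _ ≤ _ := by
          rw [← mul_add]
          gcongr
          exact ofReal_add_tailInt_le (by linarith) hanti hnn ht

lemma IsHolderGrid.weighted_diff_le {α θ : ℝ} {f : ℝ → ℝ → ℝ} {F : ℝ → ℝ → Prop}
    {φ₁ φ₂ a b : ℝ → ℝ} (h : IsHolderGrid α f F φ₁ φ₂ a b) (hα : 0 < α) (hα1 : α ≤ 1)
    (hθ : 0 < θ) (hθα : θ < α) {s t : ℝ} (hs : 0 < s) (ht : 0 < t) {y x x' : ℝ}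
    (hy : ∀ᵐ x, F x y) (hay : φ₁ y ≤ a t) (hx : F x y) (hx' : F x' y) (hd : |x - x'| = s) :
    ENNReal.ofReal (s ^ (-θ) * |f x y - f x' y|) ≤
      12 * tailInt (α - θ) (fun u => a u + b u) t := by
  rcases le_or_gt t s with hts | hst
  · obtain ⟨K, hK1, hK2⟩ := exists_nat_pow_near ((one_le_div ht).2 hts) (one_lt_two (α := ℝ))
    rw [le_div_iff₀ ht] at hK1
    rw [div_lt_iff₀ ht] at hK2
    exact h.chain hα hα1 hθ hθα hs K ht hK1 hK2 hy hay hx hx' (by rw [hd]; linarith)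
  · have ha := h.nonneg₁ t
    have hb := h.nonneg₂ t
    have hT : 0 < t ^ (α - θ) := by positivity
    have key : s ^ (-θ) * |f x y - f x' y| ≤ 12 * (t ^ (α - θ) * (a t + b t) / 2) :=
      calc s ^ (-θ) * |f x y - f x' y| ≤ s ^ (-θ) * (s ^ α * a t) := by
            gcongr
            refine (h.row y x x' hx hx').trans ?_
            rw [hd]
            gcongr
        _ = s ^ (α - θ) * a t := by
          rw [show α - θ = -θ + α by ring, Real.rpow_add hs]; ring
        _ ≤ t ^ (α - θ) * a t := by
          gcongr
        _ ≤ _ := by nlinarith [mul_nonneg hT.le hb, mul_nonneg hT.le ha]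
    calc _ ≤ ENNReal.ofReal (12 * (t ^ (α - θ) * (a t + b t) / 2)) :=
          ENNReal.ofReal_le_ofReal key
      _ = 12 * ENNReal.ofReal (t ^ (α - θ) * (a t + b t) / 2) := by
          rw [ENNReal.ofReal_mul (by norm_num)]; norm_num
      _ ≤ _ := by
          gcongr
          exact le_trans le_self_add (ofReal_add_tailInt_le (by linarith)
            (h.anti₁.add h.anti₂) (fun u => add_nonneg (h.nonneg₁ u) (h.nonneg₂ u)) ht)

lemma IsHolderGrid.lipSemiE_le {α θ : ℝ} {f : ℝ → ℝ → ℝ} {F : ℝ → ℝ → Prop}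
    {φ₁ φ₂ a b : ℝ → ℝ} (h : IsHolderGrid α f F φ₁ φ₂ a b) (hα : 0 < α) (hα1 : α ≤ 1)
    (hθ : 0 < θ) (hθα : θ < α) {t : ℝ} (ht : 0 < t) {y : ℝ}
    (hy : ∀ᵐ x, F x y) (hay : φ₁ y ≤ a t) :
    lipSemiE θ (fun x => f x y) ≤ 12 * tailInt (α - θ) (fun u => a u + b u) t := by
  refine iSup₂_le fun s hs => ?_
  have hs : 0 < s := hs
  have hs0 : ENNReal.ofReal (s ^ (-θ)) ≠ 0 := by
    simpa using Real.rpow_pos_of_pos hs (-θ)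
  rw [mul_comm, ← ENNReal.le_div_iff_mul_le (Or.inl hs0) (Or.inl ENNReal.ofReal_ne_top), einf,
    eLpNorm_exponent_top]
  refine eLpNormEssSup_le_of_ae_enorm_bound ?_
  have hshift := (measurePreserving_add_right volume s).quasiMeasurePreserving.ae hy
  filter_upwards [hy, hshift] with x hx hxs
  rw [ENNReal.le_div_iff_mul_le (Or.inl hs0) (Or.inl ENNReal.ofReal_ne_top), mul_comm,
    Real.enorm_eq_ofReal_abs, ← ENNReal.ofReal_mul (by positivity)]
  exact h.weighted_diff_le hα hα1 hθ hθα hs ht hy hay hxs hx (by simp [abs_of_pos hs])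

lemma IsHolderGrid.rearr_lipSemi_le {α θ : ℝ} {f : ℝ → ℝ → ℝ} {F : ℝ → ℝ → Prop}
    {φ₁ φ₂ a b : ℝ → ℝ} (h : IsHolderGrid α f F φ₁ φ₂ a b) (hα : 0 < α) (hα1 : α ≤ 1)
    (hθ : 0 < θ) (hθα : θ < α) {t : ℝ} (ht : 0 < t) :
    ENNReal.ofReal (rearr (fun y => lipSemi θ (fun x => f x y)) t) ≤
      12 * tailInt (α - θ) (fun u => a u + b u) t := by
  by_cases htop : 12 * tailInt (α - θ) (fun u => a u + b u) t = ⊤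
  · simp [htop]
  refine ENNReal.ofReal_le_of_le_toReal (rearr_le_of_measure_le ENNReal.toReal_nonneg ?_)
  refine le_trans (measure_mono_ae ?_) (h.meas₁ t ht)
  filter_upwards [h.ae_row] with y hy hlt
  by_contra hay
  have hle := ENNReal.toReal_mono htop (h.lipSemiE_le hα hα1 hθ hθα ht hy (not_lt.1 hay))
  have hlt' : _ < |lipSemi θ (fun x => f x y)| := hlt
  rw [abs_of_nonneg (show 0 ≤ lipSemi θ (fun x => f x y) from ENNReal.toReal_nonneg)] at hlt'
  exact absurd hle (not_le.2 hlt')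

lemma lintegral_rpow_Ioo {θ : ℝ} (hθ : 0 < θ) {r : ℝ} (hr : 0 < r) :
    ∫⁻ t in Ioo 0 r, ENNReal.ofReal (t ^ (θ - 1)) = ENNReal.ofReal (r ^ θ / θ) := by
  have h_int : IntervalIntegrable (fun t : ℝ => t ^ (θ - 1)) volume 0 r :=
    intervalIntegral.intervalIntegrable_rpow' (by linarith)
  rw [intervalIntegrable_iff_integrableOn_Ioo_of_le hr.le] at h_int
  rw [← ofReal_integral_eq_lintegral_ofReal h_int
    (ae_restrict_of_forall_mem measurableSet_Ioo fun t ht => Real.rpow_nonneg ht.1.le _),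
    ← integral_Ioc_eq_integral_Ioo, ← intervalIntegral.integral_of_le hr.le,
    integral_rpow (Or.inl (by linarith))]
  simp [Real.zero_rpow hθ.ne']

lemma lintegral_rpow_mul_tailInt_le {θ γ : ℝ} (hθ : 0 < θ) (hθ1 : θ ≤ 1) {c : ℝ → ℝ}
    (hc : AntitoneOn c (Ioi 0)) :
    ∫⁻ t in Ioi (0:ℝ), ENNReal.ofReal (t ^ (θ - 1)) * tailInt γ c t ≤
      ENNReal.ofReal (2 / θ) * ∫⁻ u in Ioi (0:ℝ), ENNReal.ofReal (u ^ (γ + θ - 1) * c u) := by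
  set w : ℝ → ℝ≥0∞ := fun u => ENNReal.ofReal (u ^ (γ - 1) * c u) with hw
  have hwm : AEMeasurable w (volume.restrict (Ioi 0)) :=
    ((by fun_prop : Measurable fun u : ℝ => u ^ (γ - 1)).aemeasurable.mul
      (aemeasurable_restrict_of_antitoneOn measurableSet_Ioi hc)).ennreal_ofReal
  set k : ℝ → ℝ → ℝ≥0∞ := fun t u =>
    {z : ℝ × ℝ | z.1 < 2 * z.2}.indicator (fun z => ENNReal.ofReal (z.1 ^ (θ - 1)) * w z.2) (t, u)
    with hk
  have hkm : AEMeasurable (Function.uncurry k)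
      ((volume.restrict (Ioi 0)).prod (volume.restrict (Ioi 0))) := by
    refine AEMeasurable.indicator ?_ (measurableSet_lt (by fun_prop) (by fun_prop))
    exact (by fun_prop : Measurable fun z : ℝ × ℝ =>
      ENNReal.ofReal (z.1 ^ (θ - 1))).aemeasurable.mul hwm.comp_snd
  have hleft : ∀ t ∈ Ioi (0:ℝ), ENNReal.ofReal (t ^ (θ - 1)) * tailInt γ c t =
      ∫⁻ u in Ioi (0:ℝ), k t u := by
    intro t ht
    have ht : 0 < t := ht
    have hks : k t = (Ioi (t / 2)).indicator fun u => ENNReal.ofReal (t ^ (θ - 1)) * w u := by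
      ext u
      simp only [hk, indicator, mem_ofPred_eq, mem_Ioi, div_lt_iff₀ (two_pos (α := ℝ)), mul_comm u]
    rw [hks, setLIntegral_indicator measurableSet_Ioi, inter_eq_left.2
      (Ioi_subset_Ioi (by positivity)), lintegral_const_mul' _ _ ENNReal.ofReal_ne_top]
    rfl
  have hright : ∀ u ∈ Ioi (0:ℝ), ∫⁻ t in Ioi (0:ℝ), k t u ≤
      ENNReal.ofReal (2 / θ) * ENNReal.ofReal (u ^ (γ + θ - 1) * c u) := by
    intro u hu
    have hu : 0 < u := hu
    have hks : (fun t => k t u) =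
        (Iio (2 * u)).indicator fun t => ENNReal.ofReal (t ^ (θ - 1)) * w u := by
      ext t
      simp only [hk, indicator, mem_ofPred_eq, mem_Iio]
    have hwt : w u ≠ ⊤ := ENNReal.ofReal_ne_top
    rw [hks, setLIntegral_indicator measurableSet_Iio, inter_comm, Ioi_inter_Iio,
      lintegral_mul_const' _ _ hwt, lintegral_rpow_Ioo hθ (by positivity),
      Real.mul_rpow (by norm_num) hu.le]
    have e : u ^ (γ + θ - 1) * c u = u ^ θ * (u ^ (γ - 1) * c u) := by
      rw [show γ + θ - 1 = θ + (γ - 1) by ring, Real.rpow_add hu, mul_assoc]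
    have h2 : (2 : ℝ) ^ θ ≤ 2 := by
      simpa using Real.rpow_le_rpow_of_exponent_le (by norm_num : (1:ℝ) ≤ 2) hθ1
    refine le_trans (mul_le_mul' (ENNReal.ofReal_le_ofReal
      (?_ : 2 ^ θ * u ^ θ / θ ≤ 2 / θ * u ^ θ)) le_rfl) (le_of_eq ?_)
    · rw [mul_div_right_comm]
      gcongr
    · rw [e, ENNReal.ofReal_mul (by positivity), ENNReal.ofReal_mul (p := u ^ θ) (by positivity),
        mul_assoc]
  calc _ = ∫⁻ t in Ioi (0:ℝ), ∫⁻ u in Ioi (0:ℝ), k t u :=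
      setLIntegral_congr_fun measurableSet_Ioi hleft
    _ = ∫⁻ u in Ioi (0:ℝ), ∫⁻ t in Ioi (0:ℝ), k t u := lintegral_lintegral_swap hkm
    _ ≤ ∫⁻ u in Ioi (0:ℝ), ENNReal.ofReal (2 / θ) * ENNReal.ofReal (u ^ (γ + θ - 1) * c u) :=
      setLIntegral_mono' measurableSet_Ioi hright
    _ = _ := lintegral_const_mul' _ _ ENNReal.ofReal_ne_top

lemma lorentz_integrand_eq {r t : ℝ} (ht : 0 < t) (x : ℝ) :
    (t ^ (1 / r) * x) ^ (1:ℝ) / t = t ^ (1 / r - 1) * x := by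
  rw [Real.rpow_one, Real.rpow_sub_one ht.ne']
  ring

lemma ofReal_lorentzNorm_le (r : ℝ) (φ : ℝ → ℝ) :
    ENNReal.ofReal (lorentzNorm r 1 φ) ≤
      ∫⁻ t in Ioi (0:ℝ), ENNReal.ofReal (t ^ (1 / r - 1)) * ENNReal.ofReal (rearr φ t) := by
  have hcongr : lorentzNorm r 1 φ = ∫ t in Ioi (0:ℝ), t ^ (1 / r - 1) * rearr φ t := by
    rw [lorentzNorm, div_one, Real.rpow_one]
    exact setIntegral_congr_fun measurableSet_Ioi fun t ht => lorentz_integrand_eq ht _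
  rw [hcongr]
  refine (ENNReal.ofReal_le_ofReal (le_abs_self _)).trans ?_
  rw [← Real.enorm_eq_ofReal_abs]
  refine (enorm_integral_le_lintegral_enorm _).trans (setLIntegral_mono' measurableSet_Ioi ?_)
  intro t ht
  have ht : 0 < t := ht
  rw [← ENNReal.ofReal_mul (by positivity), Real.enorm_eq_ofReal_abs,
    abs_of_nonneg (mul_nonneg (by positivity) (rearr_nonneg φ t))]

lemma lintegral_rearr_eq_ofReal_lorentzNorm {r : ℝ} {φ : ℝ → ℝ} (h : MemLorentz r 1 φ) :
    ∫⁻ t in Ioi (0:ℝ), ENNReal.ofReal (t ^ (1 / r - 1) * rearr φ t) =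
      ENNReal.ofReal (lorentzNorm r 1 φ) := by
  rw [lorentzNorm, div_one (1:ℝ), Real.rpow_one, ofReal_integral_eq_lintegral_ofReal h.2]
  · exact setLIntegral_congr_fun measurableSet_Ioi fun t ht => by
      simp only [lorentz_integrand_eq (show 0 < t from ht)]
  · refine ae_restrict_of_forall_mem measurableSet_Ioi fun t ht => ?_
    have ht : 0 < t := ht
    simp only [lorentz_integrand_eq ht, Pi.zero_apply]
    exact mul_nonneg (by positivity) (rearr_nonneg φ t)

lemma lorentzNorm_one_nonneg (r : ℝ) (φ : ℝ → ℝ) : 0 ≤ lorentzNorm r 1 φ := by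
  refine Real.rpow_nonneg (setIntegral_nonneg measurableSet_Ioi fun t ht => ?_) _
  have ht : 0 < t := ht
  rw [lorentz_integrand_eq ht]
  exact mul_nonneg (by positivity) (rearr_nonneg φ t)

lemma lipSemi_nonneg (α : ℝ) (φ : ℝ → ℝ) : 0 ≤ lipSemi α φ := ENNReal.toReal_nonneg

lemma exists_isHolderGrid {α : ℝ} (hα : 0 < α) {f : ℝ → ℝ → ℝ}
    (hf : Measurable (Function.uncurry f))
    (hy : ∀ᵐ y, MemLip α (fun x => f x y)) (hx : ∀ᵐ x, MemLip α (fun y => f x y))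
    (h1 : S0 fun y => lipSemi α fun x => f x y) (h2 : S0 fun x => lipSemi α fun y => f x y) :
    ∃ F, IsHolderGrid α f F (fun y => lipSemi α fun x => f x y)
      (fun x => lipSemi α fun y => f x y) (rearr fun y => lipSemi α fun x => f x y)
      (rearr fun x => lipSemi α fun y => f x y) := by
  have hf' : Measurable (Function.uncurry fun y x => f x y) := hf.comp measurable_swap
  have hrow : ∀ᵐ y, ∀ᵐ x, x ∈ holderPts α (lipSemi α fun x => f x y) (fun x => f x y) := by
    filter_upwards [hy] with y h
    exact ae_mem_holderPts hα (hf'.comp measurable_prodMk_left) h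
  have hcol : ∀ᵐ x, ∀ᵐ y, y ∈ holderPts α (lipSemi α fun y => f x y) (fun y => f x y) := by
    filter_upwards [hx] with x h
    exact ae_mem_holderPts hα (hf.comp measurable_prodMk_left) h
  have hrow' := (Measure.ae_ae_comm (measurableSet_setOf_mem_holderPts hf' h1.1)).1 hrow
  have hcol' := (Measure.ae_ae_comm (measurableSet_setOf_mem_holderPts hf h2.1)).1 hcol
  have hdist {φ : ℝ → ℝ} (h : S0 φ) (h0 : ∀ x, 0 ≤ φ x) (t : ℝ) (ht : 0 < t) :
      volume {x | rearr φ t < φ x} ≤ ENNReal.ofReal t := by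
    simpa only [abs_of_nonneg (h0 _)] using measure_rearr_lt_le h ht
  exact ⟨fun x y => x ∈ holderPts α (lipSemi α fun x => f x y) (fun x => f x y) ∧
      y ∈ holderPts α (lipSemi α fun y => f x y) (fun y => f x y),
    { row := fun y x x' h h' => abs_sub_le_of_mem_holderPts (φ := fun x => f x y) hα h.1 h'.1
      col := fun x y y' h h' => abs_sub_le_of_mem_holderPts (φ := fun y => f x y) hα h.2 h'.2
      ae_row := by
        filter_upwards [hrow, hcol'] with y h h' using h.and h'
      ae_col := by
        filter_upwards [hrow', hcol] with x h h' using h.and h'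
      anti₁ := rearr_antitoneOn h1
      anti₂ := rearr_antitoneOn h2
      const_nonneg₁ := fun _ => lipSemi_nonneg _ _
      const_nonneg₂ := fun _ => lipSemi_nonneg _ _
      nonneg₁ := rearr_nonneg _
      nonneg₂ := rearr_nonneg _
      meas₁ := hdist h1 fun _ => lipSemi_nonneg _ _
      meas₂ := hdist h2 fun _ => lipSemi_nonneg _ _ }⟩

lemma IsHolderGrid.lorentzNorm_le {p q : ℝ} (hp : 1 ≤ p) (hpq : p < q) {f : ℝ → ℝ → ℝ}
    {F : ℝ → ℝ → Prop} {φ₁ φ₂ ψ₁ ψ₂ : ℝ → ℝ}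
    (h : IsHolderGrid (1 / p) f F φ₁ φ₂ (rearr ψ₁) (rearr ψ₂))
    (h1 : MemLorentz p 1 ψ₁) (h2 : MemLorentz p 1 ψ₂) :
    lorentzNorm q 1 (fun y => lipSemi (1 / q) (fun x => f x y)) ≤
      24 * q * (lorentzNorm p 1 ψ₁ + lorentzNorm p 1 ψ₂) := by
  have hp0 : 0 < p := by linarith
  have hq0 : 0 < q := by linarith
  have hα1 : 1 / p ≤ 1 := (div_le_one hp0).2 hp
  have hθα : 1 / q < 1 / p := one_div_lt_one_div_of_lt hp0 hpq
  have hθ : 0 < 1 / q := by positivity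
  have hanti : AntitoneOn (fun u => rearr ψ₁ u + rearr ψ₂ u) (Ioi 0) := h.anti₁.add h.anti₂
  have hn1 := lorentzNorm_one_nonneg p ψ₁
  have hn2 := lorentzNorm_one_nonneg p ψ₂
  have hsum : ∫⁻ u in Ioi (0:ℝ), ENNReal.ofReal
      (u ^ (1 / p - 1 / q + 1 / q - 1) * (rearr ψ₁ u + rearr ψ₂ u)) =
      ENNReal.ofReal (lorentzNorm p 1 ψ₁ + lorentzNorm p 1 ψ₂) := by
    rw [ENNReal.ofReal_add hn1 hn2, ← lintegral_rearr_eq_ofReal_lorentzNorm h1,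
      ← lintegral_rearr_eq_ofReal_lorentzNorm h2, ← lintegral_add_left']
    · refine setLIntegral_congr_fun measurableSet_Ioi fun u hu => ?_
      have hu : 0 < u := hu
      have e1 := rearr_nonneg ψ₁ u
      have e2 := rearr_nonneg ψ₂ u
      simp only [sub_add_cancel]
      rw [mul_add, ENNReal.ofReal_add (by positivity) (by positivity)]
    · exact ((by fun_prop : Measurable fun u : ℝ => u ^ (1 / p - 1)).aemeasurable.mul
        (aemeasurable_restrict_of_antitoneOn measurableSet_Ioi h.anti₁)).ennreal_ofReal
  rw [← ENNReal.ofReal_le_ofReal_iff (by positivity)]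
  calc _ ≤ ∫⁻ t in Ioi (0:ℝ), ENNReal.ofReal (t ^ (1 / q - 1)) *
        ENNReal.ofReal (rearr (fun y => lipSemi (1 / q) (fun x => f x y)) t) :=
        ofReal_lorentzNorm_le _ _
    _ ≤ ∫⁻ t in Ioi (0:ℝ), 12 * (ENNReal.ofReal (t ^ (1 / q - 1)) *
        tailInt (1 / p - 1 / q) (fun u => rearr ψ₁ u + rearr ψ₂ u) t) := by
      refine setLIntegral_mono' measurableSet_Ioi fun t ht => ?_
      rw [mul_left_comm]
      gcongr
      exact h.rearr_lipSemi_le (by positivity) hα1 hθ hθα ht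
    _ ≤ 12 * (ENNReal.ofReal (2 / (1 / q)) *
        ENNReal.ofReal (lorentzNorm p 1 ψ₁ + lorentzNorm p 1 ψ₂)) := by
      rw [lintegral_const_mul' _ _ (by norm_num), ← hsum]
      gcongr
      exact lintegral_rpow_mul_tailInt_le hθ (by linarith) hanti
    _ = _ := by
      rw [show (12 : ℝ≥0∞) = ENNReal.ofReal 12 by norm_num, ← ENNReal.ofReal_mul (by positivity),
        ← ENNReal.ofReal_mul (by positivity)]
      congr 1
      field_simp
      ring

/-- Let `1 ≤ p < q < ∞` and let `f` be measurable on `ℝ²` with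
a.e. sections in `Lip (1/p)` and `φ_{p,1}, φ_{p,2} ∈ L^{p,1}(ℝ)`. Then
`‖φ_{q,1}‖_{q,1} + ‖φ_{q,2}‖_{q,1} ≤ 2⁷ q (‖φ_{p,1}‖_{p,1} + ‖φ_{p,2}‖_{p,1})`. -/
theorem stmt17 (p q : ℝ) (hp : 1 ≤ p) (hpq : p < q) (f : ℝ × ℝ → ℝ)
    (hf : Measurable f)
    (hy : ∀ᵐ y : ℝ ∂volume, MemLip (1/p) (fun x => f (x, y)))
    (hx : ∀ᵐ x : ℝ ∂volume, MemLip (1/p) (fun y => f (x, y)))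
    (hL1 : MemLorentz p 1 (fun y => lipSemi (1/p) (fun x => f (x, y))))
    (hL2 : MemLorentz p 1 (fun x => lipSemi (1/p) (fun y => f (x, y)))) :
    lorentzNorm q 1 (fun y => lipSemi (1/q) (fun x => f (x, y))) +
        lorentzNorm q 1 (fun x => lipSemi (1/q) (fun y => f (x, y))) ≤
      2 ^ 7 * q *
        (lorentzNorm p 1 (fun y => lipSemi (1/p) (fun x => f (x, y))) +
         lorentzNorm p 1 (fun x => lipSemi (1/p) (fun y => f (x, y)))) := by
  obtain ⟨F, hF⟩ := exists_isHolderGrid (f := fun x y => f (x, y)) (by positivity) hf hy hx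
    hL1.1 hL2.1
  have e1 := hF.lorentzNorm_le hp hpq hL1 hL2
  have e2 := hF.swap.lorentzNorm_le hp hpq hL2 hL1
  have hn1 := lorentzNorm_one_nonneg p fun y => lipSemi (1/p) fun x => f (x, y)
  have hn2 := lorentzNorm_one_nonneg p fun x => lipSemi (1/p) fun y => f (x, y)
  have hq : 0 < q := by linarith
  nlinarith [mul_nonneg hq.le hn1, mul_nonneg hq.le hn2]

end
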